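/- Let R(q) = (q,q^4;q^5)_∞/(q^2,q^3;q^5)_∞ and E(q)=(q;q)_∞. Then R(q) R(q^2)/R(q^4)^2 + q^2 R(q^4)^2/(R(q) R(q^2)) = E(q^2) E(q^5)^5/(E(q) E(q^{10})^5) - 2q. -/

import Mathlib

/-- Euler's product E(q) = ∏_{k≥0} (1 - q^{k+1}). -/
noncomputable def E (q : ℂ) : ℂ := ∏' k : ℕ, (1 - q ^ (k + 1))

/-- q-Pochhammer infinite product (a;q)_∞ = ∏_{k≥0} (1 - a q^k). -/
noncomputable def qp (a q : ℂ) : ℂ := ∏' k : ℕ, (1 - a * q ^ k)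

/-- Rogers–Ramanujan function G(q) = 1/((q,q^4;q^5)_∞). -/
noncomputable def G (q : ℂ) : ℂ := 1 / (qp q (q ^ 5) * qp (q ^ 4) (q ^ 5))

/-- Rogers–Ramanujan function H(q) = 1/((q^2,q^3;q^5)_∞). -/
noncomputable def H (q : ℂ) : ℂ := 1 / (qp (q ^ 2) (q ^ 5) * qp (q ^ 3) (q ^ 5))

/-- Rogers–Ramanujan continued fraction product R(q). -/
noncomputable def R (q : ℂ) : ℂ :=
  (qp q (q ^ 5) * qp (q ^ 4) (q ^ 5)) / (qp (q ^ 2) (q ^ 5) * qp (q ^ 3) (q ^ 5))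

theorem summable_sq_pow_mul_pow {a b : ℝ} (ha : 0 < a) (ha1 : a < 1) (hb : 0 < b) :
    Summable fun n : ℕ ↦ a ^ (n ^ 2) * b ^ n := by
  refine summable_of_ratio_test_tendsto_lt_one (l := 0) one_pos
    (.of_forall fun n ↦ by positivity) ?_
  have h : Filter.Tendsto (fun n : ℕ ↦ a ^ n * a ^ n * (a * b)) .atTop (nhds 0) := by
    have h0 := tendsto_pow_atTop_nhds_zero_of_lt_one ha.le ha1
    simpa using (h0.mul h0).mul_const (a * b)
  refine h.congr fun n ↦ ?_
  rw [Real.norm_of_nonneg (by positivity), Real.norm_of_nonneg (by positivity),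
    eq_div_iff (by positivity)]
  ring

theorem summable_norm_theta {s w : ℂ} (hs0 : s ≠ 0) (hs : ‖s‖ < 1) (hw : w ≠ 0) :
    Summable fun j : ℤ ↦ ‖s ^ (j ^ 2) * w ^ j‖ := by
  have h0 : 0 < ‖s‖ := norm_pos_iff.2 hs0
  have h1 : 0 < ‖w‖ := norm_pos_iff.2 hw
  refine Summable.of_nat_of_neg ?_ ?_
  · refine (summable_sq_pow_mul_pow h0 hs h1).congr fun n ↦ ?_
    rw [norm_mul, norm_zpow, norm_zpow, zpow_natCast]
    norm_cast
  · refine (summable_sq_pow_mul_pow h0 hs (inv_pos.2 h1)).congr fun n ↦ ?_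
    rw [norm_mul, norm_zpow, norm_zpow, zpow_neg, zpow_natCast, neg_sq, inv_pow]
    norm_cast

/-- The theta series `∑ (-1)^j s^(j²) w^j`. -/
noncomputable def thetaSum (s w : ℂ) : ℂ := ∑' j : ℤ, (-1) ^ j * (s ^ (j ^ 2) * w ^ j)

/-- The even-index part `∑ s^(2k²) x^(2k)`, arising from products of two theta series. -/
noncomputable def evenTheta (s x : ℂ) : ℂ := ∑' k : ℤ, s ^ (2 * k ^ 2) * x ^ (2 * k)

/-- The odd-index part `∑ s^(2k²+2k) x^(2k+1)`, arising from products of two theta series. -/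
noncomputable def oddTheta (s x : ℂ) : ℂ := ∑' k : ℤ, s ^ (2 * k ^ 2 + 2 * k) * x ^ (2 * k + 1)

theorem summable_norm_thetaSum {s w : ℂ} (hs0 : s ≠ 0) (hs : ‖s‖ < 1) (hw : w ≠ 0) :
    Summable fun j : ℤ ↦ ‖(-1) ^ j * (s ^ (j ^ 2) * w ^ j)‖ :=
  (summable_norm_theta hs0 hs hw).congr fun j ↦ by simp

theorem summable_norm_evenTheta {s x : ℂ} (hs0 : s ≠ 0) (hs : ‖s‖ < 1) (hx : x ≠ 0) :
    Summable fun k : ℤ ↦ ‖s ^ (2 * k ^ 2) * x ^ (2 * k)‖ := by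
  have h2 : ‖s ^ 2‖ < 1 := by rw [norm_pow]; exact pow_lt_one₀ (norm_nonneg _) hs two_ne_zero
  refine (summable_norm_theta (pow_ne_zero 2 hs0) h2 (pow_ne_zero 2 hx)).congr fun k ↦ ?_
  rw [zpow_mul, zpow_mul]
  norm_cast

theorem summable_norm_oddTheta {s x : ℂ} (hs0 : s ≠ 0) (hs : ‖s‖ < 1) (hx : x ≠ 0) :
    Summable fun k : ℤ ↦ ‖s ^ (2 * k ^ 2 + 2 * k) * x ^ (2 * k + 1)‖ := by
  refine ((summable_norm_evenTheta hs0 hs (mul_ne_zero hs0 hx)).mul_right ‖x‖).congr fun k ↦ ?_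
  rw [← norm_mul, zpow_add₀ hs0, zpow_add₀ hx, mul_zpow, zpow_one]
  ring_nf

/-- Splits a sum over `ℤ × ℤ` according to the parity of the sum of the coordinates. -/
theorem HasSum.int_pair_parity {f : ℤ × ℤ → ℂ} {a b : ℂ}
    (h₁ : HasSum (fun p : ℤ × ℤ ↦ f (p.1 + p.2, p.1 - p.2)) a)
    (h₂ : HasSum (fun p : ℤ × ℤ ↦ f (p.1 + p.2 + 1, p.1 - p.2)) b) : HasSum f (a + b) := by
  let g : (ℤ × ℤ) ⊕ (ℤ × ℤ) → ℤ × ℤ :=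
    Sum.elim (fun p ↦ (p.1 + p.2, p.1 - p.2)) (fun p ↦ (p.1 + p.2 + 1, p.1 - p.2))
  have hg : Function.Bijective g := by
    constructor
    · rintro (⟨a, b⟩ | ⟨a, b⟩) (⟨c, d⟩ | ⟨c, d⟩) h <;> simp [g] at h ⊢ <;> omega
    · rintro ⟨m, n⟩
      rcases Int.even_or_odd' (m + n) with ⟨k, hk | hk⟩
      · exact ⟨.inl (k, m - k), by simp [g]; omega⟩
      · exact ⟨.inr (k, m - k - 1), by simp [g]; omega⟩
  exact (Equiv.ofBijective g hg).hasSum_iff.1 (HasSum.sum h₁ h₂)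

theorem thetaSum_term_even {s x y : ℂ} (hs0 : s ≠ 0) (hx : x ≠ 0) (hy : y ≠ 0) (k l : ℤ) :
    ((-1) ^ (k + l) * (s ^ ((k + l) ^ 2) * (x * y) ^ (k + l))) *
      ((-1) ^ (k - l) * (s ^ ((k - l) ^ 2) * (x / y) ^ (k - l))) =
    (s ^ (2 * k ^ 2) * x ^ (2 * k)) * (s ^ (2 * l ^ 2) * y ^ (2 * l)) := by
  have h1 : 2 * k ^ 2 + 2 * l ^ 2 = (k + l) ^ 2 + (k - l) ^ 2 := by ring
  have h2 : (-1 : ℂ) ^ (k + l) * (-1) ^ (k - l) = 1 := by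
    rw [← zpow_add₀ (by norm_num)]
    exact Even.neg_one_zpow ⟨k, by ring⟩
  have h3 : (x * y) ^ (k + l) * (x / y) ^ (k - l) = x ^ (2 * k) * y ^ (2 * l) := by
    rw [mul_zpow, div_zpow, zpow_add₀ hx, zpow_add₀ hy, zpow_sub₀ hx, zpow_sub₀ hy, two_mul,
      two_mul, zpow_add₀ hx, zpow_add₀ hy]
    field_simp
  have h4 : s ^ (2 * k ^ 2) * s ^ (2 * l ^ 2) = s ^ ((k + l) ^ 2) * s ^ ((k - l) ^ 2) := by
    rw [← zpow_add₀ hs0, ← zpow_add₀ hs0, h1]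
  calc _ = ((-1) ^ (k + l) * (-1) ^ (k - l)) * (s ^ ((k + l) ^ 2) * s ^ ((k - l) ^ 2)) *
        ((x * y) ^ (k + l) * (x / y) ^ (k - l)) := by
          simp only [mul_assoc, mul_left_comm, mul_comm]
    _ = _ := by
      rw [h2, h3, ← h4, one_mul]
      simp only [mul_assoc, mul_left_comm, mul_comm]

theorem thetaSum_term_odd {s x y : ℂ} (hs0 : s ≠ 0) (hx : x ≠ 0) (hy : y ≠ 0) (k l : ℤ) :
    ((-1) ^ (k + l + 1) * (s ^ ((k + l + 1) ^ 2) * (x * y) ^ (k + l + 1))) *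
      ((-1) ^ (k - l) * (s ^ ((k - l) ^ 2) * (x / y) ^ (k - l))) =
    -s * ((s ^ (2 * k ^ 2 + 2 * k) * x ^ (2 * k + 1)) *
      (s ^ (2 * l ^ 2 + 2 * l) * y ^ (2 * l + 1))) := by
  have h1 : 1 + (2 * k ^ 2 + 2 * k) + (2 * l ^ 2 + 2 * l) = (k + l + 1) ^ 2 + (k - l) ^ 2 := by
    ring
  have h2 : (-1 : ℂ) ^ (k + l + 1) * (-1) ^ (k - l) = -1 := by
    rw [← zpow_add₀ (by norm_num)]
    exact Odd.neg_one_zpow ⟨k, by ring⟩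
  have h3 : (x * y) ^ (k + l + 1) * (x / y) ^ (k - l) =
      x ^ (2 * k + 1) * y ^ (2 * l + 1) := by
    rw [mul_zpow, div_zpow, zpow_add_one₀ hx, zpow_add_one₀ hy, zpow_add₀ hx, zpow_add₀ hy,
      zpow_sub₀ hx, zpow_sub₀ hy, zpow_add_one₀ hx, zpow_add_one₀ hy, two_mul, two_mul,
      zpow_add₀ hx, zpow_add₀ hy]
    field_simp
  have h4 : s * s ^ (2 * k ^ 2 + 2 * k) * s ^ (2 * l ^ 2 + 2 * l) =
      s ^ ((k + l + 1) ^ 2) * s ^ ((k - l) ^ 2) := by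
    rw [← zpow_add₀ hs0, ← h1, zpow_add₀ hs0 _ (2 * l ^ 2 + 2 * l), zpow_add₀ hs0 1, zpow_one]
  calc _ = ((-1) ^ (k + l + 1) * (-1) ^ (k - l)) *
        (s ^ ((k + l + 1) ^ 2) * s ^ ((k - l) ^ 2)) *
        ((x * y) ^ (k + l + 1) * (x / y) ^ (k - l)) := by
          simp only [mul_assoc, mul_left_comm, mul_comm]
    _ = _ := by
      rw [h2, h3, ← h4, neg_one_mul, neg_mul, neg_mul]
      simp only [mul_assoc, mul_left_comm, mul_comm]

theorem thetaSum_mul_thetaSum_div {s x y : ℂ} (hs0 : s ≠ 0) (hs : ‖s‖ < 1) (hx : x ≠ 0)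
    (hy : y ≠ 0) :
    thetaSum s (x * y) * thetaSum s (x / y) =
      evenTheta s x * evenTheta s y + -s * (oddTheta s x * oddTheta s y) := by
  have key {u v : ℤ → ℂ} (hu : Summable fun j ↦ ‖u j‖) (hv : Summable fun j ↦ ‖v j‖) :
      HasSum (fun p : ℤ × ℤ ↦ u p.1 * v p.2) ((∑' j, u j) * ∑' j, v j) :=
    hu.of_norm.hasSum.mul hv.of_norm.hasSum (summable_mul_of_summable_norm hu hv)
  have hL := key (summable_norm_thetaSum hs0 hs (mul_ne_zero hx hy))
    (summable_norm_thetaSum hs0 hs (div_ne_zero hx hy))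
  have hE := key (summable_norm_evenTheta hs0 hs hx) (summable_norm_evenTheta hs0 hs hy)
  have hO := (key (summable_norm_oddTheta hs0 hs hx)
    (summable_norm_oddTheta hs0 hs hy)).mul_left (-s)
  simp only [← thetaSum_term_even hs0 hx hy] at hE
  simp only [← thetaSum_term_odd hs0 hx hy] at hO
  rw [thetaSum, thetaSum, evenTheta, evenTheta, oddTheta, oddTheta]
  refine hL.unique ?_
  generalize hf : (fun p : ℤ × ℤ ↦ (-1) ^ p.1 * (s ^ (p.1 ^ 2) * (x * y) ^ p.1) *
      ((-1) ^ p.2 * (s ^ (p.2 ^ 2) * (x / y) ^ p.2))) = f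
  apply HasSum.int_pair_parity
  · subst hf
    exact hE
  · subst hf
    exact hO

theorem evenTheta_mul_self_arg {s x : ℂ} (hs0 : s ≠ 0) (hx : x ≠ 0) :
    evenTheta s (x * s) = oddTheta s x / x := by
  rw [eq_div_iff hx, evenTheta, oddTheta, ← tsum_mul_right]
  refine tsum_congr fun k ↦ ?_
  rw [mul_zpow, zpow_add₀ hs0, zpow_add₀ hx, zpow_one]
  ring

theorem oddTheta_mul_self_arg {s x : ℂ} (hs0 : s ≠ 0) (hx : x ≠ 0) :
    oddTheta s (x * s) = evenTheta s x / (s * x) := by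
  rw [eq_div_iff (mul_ne_zero hs0 hx), evenTheta, oddTheta, ← tsum_mul_right,
    ← (Equiv.addRight (1 : ℤ)).tsum_eq fun k ↦ s ^ (2 * k ^ 2) * x ^ (2 * k)]
  refine tsum_congr fun k ↦ ?_
  have h1 : 2 * (k + 1) ^ 2 = (2 * k ^ 2 + 2 * k) + (2 * k + 1) + 1 := by ring
  have h2 : 2 * (k + 1) = (2 * k + 1) + 1 := by ring
  rw [Equiv.coe_addRight, h1, h2, mul_zpow, zpow_add_one₀ hs0 (_ + _), zpow_add_one₀ hx (_ + _),
    zpow_add₀ hs0 _ (_ + 1)]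
  ring

theorem thetaSum_inv (s w : ℂ) : thetaSum s w⁻¹ = thetaSum s w := by
  rw [thetaSum, ← (Equiv.neg ℤ).tsum_eq]
  refine tsum_congr fun j ↦ ?_
  have h : (-1 : ℂ) ^ (-j) = (-1) ^ j := by rw [zpow_neg, ← inv_zpow, inv_neg_one]
  rw [Equiv.neg_apply, h, neg_sq, inv_zpow, ← zpow_neg, neg_neg]

theorem thetaSum_mul_sq {s w : ℂ} (hs0 : s ≠ 0) (hw : w ≠ 0) :
    thetaSum s (w * s ^ 2) = -(thetaSum s w / (w * s)) := by
  rw [← neg_div, eq_div_iff (mul_ne_zero hw hs0), thetaSum, thetaSum, ← tsum_mul_right, ← tsum_neg,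
    ← (Equiv.addRight (1 : ℤ)).tsum_eq fun j ↦ -((-1 : ℂ) ^ j * (s ^ (j ^ 2) * w ^ j))]
  refine tsum_congr fun j ↦ ?_
  have h1 : (j + 1) ^ 2 = j ^ 2 + (2 * j) + 1 := by ring
  have h2 : (s ^ 2) ^ j = s ^ (2 * j) := by rw [zpow_mul]; norm_cast
  rw [Equiv.coe_addRight, h1, mul_zpow, h2, zpow_add₀ hs0 _ 1, zpow_add₀ hs0, zpow_add₀ hw,
    zpow_add₀ (by norm_num), zpow_one, zpow_one, zpow_one]
  ring

/-- The product `y θ(xys) θ(x/(ys))` is a `2 × 2` determinant. -/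
theorem thetaSum_shift_mul {s x y : ℂ} (hs0 : s ≠ 0) (hs : ‖s‖ < 1) (hx : x ≠ 0) (hy : y ≠ 0) :
    y * (thetaSum s (x * (y * s)) * thetaSum s (x / (y * s))) =
      evenTheta s x * oddTheta s y - oddTheta s x * evenTheta s y := by
  rw [thetaSum_mul_thetaSum_div hs0 hs hx (mul_ne_zero hy hs0), evenTheta_mul_self_arg hs0 hy,
    oddTheta_mul_self_arg hs0 hy]
  field_simp
  ring

theorem summable_norm_geometric (a : ℂ) {b : ℂ} (hb : ‖b‖ < 1) :
    Summable fun k : ℕ ↦ ‖-(a * b ^ k)‖ := by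
  simpa [norm_mul, norm_pow] using (summable_geometric_of_lt_one (norm_nonneg b) hb).mul_left ‖a‖

theorem multipliable_qp (a : ℂ) {b : ℂ} (hb : ‖b‖ < 1) :
    Multipliable fun k : ℕ ↦ 1 - a * b ^ k := by
  simpa only [sub_eq_add_neg] using
    multipliable_one_add_of_summable (summable_norm_geometric a hb)

theorem tendsto_qp (a : ℂ) {b : ℂ} (hb : ‖b‖ < 1) :
    Filter.Tendsto (fun n ↦ ∏ k ∈ Finset.range n, (1 - a * b ^ k)) .atTop (nhds (qp a b)) :=
  (multipliable_qp a hb).hasProd.tendsto_prod_nat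

theorem one_sub_mul_pow_ne_zero {a b : ℂ} (ha : ‖a‖ < 1) (hb : ‖b‖ < 1) (k : ℕ) :
    1 - a * b ^ k ≠ 0 := by
  intro h
  have h1 : ‖a * b ^ k‖ = 1 := by rw [← sub_eq_zero.1 h, norm_one]
  rw [norm_mul, norm_pow] at h1
  have h2 : ‖b‖ ^ k ≤ 1 := pow_le_one₀ (norm_nonneg _) hb.le
  nlinarith [norm_nonneg a]

theorem qp_ne_zero {a b : ℂ} (ha : ‖a‖ < 1) (hb : ‖b‖ < 1) : qp a b ≠ 0 := by
  simpa only [qp, sub_eq_add_neg] using tprod_one_add_ne_zero_of_summable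
    (fun k ↦ by simpa only [sub_eq_add_neg] using one_sub_mul_pow_ne_zero ha hb k)
    (summable_norm_geometric a hb)

theorem qp_eq_prod (a : ℂ) {b : ℂ} (hb : ‖b‖ < 1) {n : ℕ} (hn : n ≠ 0) :
    qp a b = ∏ i ∈ Finset.range n, qp (a * b ^ i) (b ^ n) := by
  have hbn : ‖b ^ n‖ < 1 := by rw [norm_pow]; exact pow_lt_one₀ (norm_nonneg _) hb hn
  have h1 := tendsto_finsetProd (Finset.range n) fun i _ ↦ tendsto_qp (a * b ^ i) hbn
  have h2 := (tendsto_qp a hb).comp (Filter.tendsto_id.nsmul_atTop (Nat.pos_of_ne_zero hn))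
  refine tendsto_nhds_unique h2 (h1.congr fun N ↦ ?_)
  simp only [Function.comp_apply, id, smul_eq_mul]
  induction N with
  | zero => simp
  | succ N ih =>
    simp only [Finset.prod_range_succ, Finset.prod_mul_distrib] at ih ⊢
    rw [ih, mul_add, mul_one, Finset.prod_range_add]
    congr 1
    refine Finset.prod_congr rfl fun i _ ↦ ?_
    ring

/-- The finite product `(p; p)_n`. -/
noncomputable def poch (p : ℂ) (n : ℕ) : ℂ := ∏ k ∈ Finset.range n, (1 - p * p ^ k)

/-- The reciprocal of `(p; p)_m`, extended by zero to negative `m`. -/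
noncomputable def invPoch (p : ℂ) (m : ℤ) : ℂ := if m < 0 then 0 else (poch p m.toNat)⁻¹

theorem poch_ne_zero {p : ℂ} (hp : ‖p‖ < 1) (n : ℕ) : poch p n ≠ 0 :=
  Finset.prod_ne_zero_iff.2 fun k _ ↦ one_sub_mul_pow_ne_zero hp hp k

theorem tendsto_poch {p : ℂ} (hp : ‖p‖ < 1) :
    Filter.Tendsto (poch p) .atTop (nhds (qp p p)) :=
  tendsto_qp p hp

theorem invPoch_sub_one {p : ℂ} (hp : ‖p‖ < 1) (m : ℤ) :
    invPoch p (m - 1) = (1 - p ^ m) * invPoch p m := by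
  rcases lt_or_ge m 0 with h | h
  · simp [invPoch, h, show m - 1 < 0 by omega]
  · obtain ⟨n, rfl⟩ := Int.eq_ofNat_of_zero_le h
    cases n with
    | zero => simp [invPoch]
    | succ n =>
      have h1 := poch_ne_zero hp (n + 1)
      have h2 := poch_ne_zero hp n
      have h3 : poch p (n + 1) = poch p n * (1 - p ^ (n + 1)) := by
        rw [poch, Finset.prod_range_succ, poch, pow_succ']
      have h4 : ((n + 1 : ℕ) : ℤ) - 1 = n := by push_cast; ring
      rw [h4, invPoch, invPoch, if_neg (by omega), if_neg (by omega), Int.toNat_natCast,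
        Int.toNat_natCast, zpow_natCast]
      field_simp
      rw [h3]

theorem tendsto_invPoch {p : ℂ} (hp : ‖p‖ < 1) :
    Filter.Tendsto (invPoch p) .atTop (nhds (qp p p)⁻¹) := by
  have h := ((tendsto_poch hp).inv₀ (qp_ne_zero hp hp)).comp
    (Filter.tendsto_atTop_atTop.2 fun b ↦ ⟨(b : ℤ), fun a ha ↦ by omega⟩ :
      Filter.Tendsto Int.toNat .atTop .atTop)
  refine h.congr' ?_
  filter_upwards [Filter.eventually_ge_atTop 0] with m hm
  simp [invPoch, not_lt.2 hm]

theorem exists_norm_invPoch_le {p : ℂ} (hp : ‖p‖ < 1) :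
    ∃ M : ℝ, 0 ≤ M ∧ ∀ m, ‖invPoch p m‖ ≤ M := by
  obtain ⟨M, hM⟩ := ((tendsto_poch hp).inv₀ (qp_ne_zero hp hp)).norm.bddAbove_range
  have h0 : 0 ≤ M := (norm_nonneg _).trans (hM ⟨0, rfl⟩)
  refine ⟨M, h0, fun m ↦ ?_⟩
  rw [invPoch]
  split_ifs
  · simpa using h0
  · exact hM ⟨m.toNat, rfl⟩

/-- The finite form of the Jacobi triple product identity. -/
theorem hasSum_finite_triple_product {s w : ℂ} (hs0 : s ≠ 0) (hs : ‖s‖ < 1) (hw : w ≠ 0) (n : ℕ) :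
    HasSum (fun j : ℤ ↦ (-1) ^ j * (s ^ (j ^ 2) * w ^ j) *
        (invPoch (s ^ 2) (n - j) * invPoch (s ^ 2) (n + j)))
      ((∏ k ∈ Finset.range n, ((1 - w * s * (s ^ 2) ^ k) * (1 - w⁻¹ * s * (s ^ 2) ^ k))) /
        poch (s ^ 2) (2 * n)) := by
  have hp : ‖s ^ 2‖ < 1 := by rw [norm_pow]; exact pow_lt_one₀ (norm_nonneg _) hs two_ne_zero
  have hp0 : s ^ 2 ≠ 0 := pow_ne_zero 2 hs0
  induction n with
  | zero =>
    convert hasSum_single (0 : ℤ) fun j hj ↦ ?_ using 1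
    · simp [poch, invPoch]
    · rcases lt_or_gt_of_ne hj with h | h <;> simp [invPoch, h]
  | succ n ih =>
    have hl := ((Equiv.subRight (1 : ℤ)).hasSum_iff.2 ih).mul_left (-(w * s ^ (2 * n + 1)))
    have hr := ((Equiv.addRight (1 : ℤ)).hasSum_iff.2 ih).mul_left (-(w⁻¹ * s ^ (2 * n + 1)))
    have h := ((ih.mul_left (1 + s ^ (4 * n + 2))).add (hl.add hr)).mul_left
      ((1 - (s ^ 2) ^ (2 * n + 1)) * (1 - (s ^ 2) ^ (2 * n + 2)))⁻¹
    have hc1 : 1 - (s ^ 2) ^ (2 * n + 1) ≠ 0 := by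
      rw [pow_succ']; exact one_sub_mul_pow_ne_zero hp hp _
    have hc2 : 1 - (s ^ 2) ^ (2 * n + 2) ≠ 0 := by
      rw [pow_succ' _ (2 * n + 1)]; exact one_sub_mul_pow_ne_zero hp hp _
    refine Eq.mp (congrArg₂ (fun f v ↦ HasSum f v) (funext fun j ↦ Eq.symm ?_) (Eq.symm ?_)) h
    · rw [eq_inv_mul_iff_mul_eq₀ (mul_ne_zero hc1 hc2)]
      simp only [Function.comp_apply, Equiv.coe_addRight, Equiv.subRight_apply]
      obtain ⟨a, ha⟩ : ∃ a : ℤ, a = n + 1 - j := ⟨_, rfl⟩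
      obtain ⟨b, hb⟩ : ∃ b : ℤ, b = n + 1 + j := ⟨_, rfl⟩
      rw [show ((n + 1 : ℕ) : ℤ) - j = a by push_cast; omega,
        show ((n + 1 : ℕ) : ℤ) + j = b by push_cast; omega,
        show (n : ℤ) - j = a - 1 by omega, show (n : ℤ) + j = b - 1 by omega,
        show (n : ℤ) - (j - 1) = a by omega, show (n : ℤ) + (j - 1) = b - 1 - 1 by omega,
        show (n : ℤ) - (j + 1) = a - 1 - 1 by omega, show (n : ℤ) + (j + 1) = b by omega,
        invPoch_sub_one hp (a - 1), invPoch_sub_one hp (b - 1), invPoch_sub_one hp a,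
        invPoch_sub_one hp b, zpow_sub_one₀ hp0, zpow_sub_one₀ hp0]
      have e1 : (s ^ 2) ^ a * (s ^ 2) ^ b = (s ^ 2) ^ (2 * n + 2) := by
        rw [← zpow_add₀ hp0, ← zpow_natCast (s ^ 2)]; congr 1; push_cast; omega
      have e2 : s ^ (2 * n + 1) * s ^ ((j - 1) ^ 2) = s ^ (j ^ 2) * (s ^ 2) ^ a := by
        rw [← zpow_natCast s 2, ← zpow_mul, ← zpow_natCast s, ← zpow_add₀ hs0, ← zpow_add₀ hs0, ha]
        congr 1; push_cast; ring
      have e3 : s ^ (2 * n + 1) * s ^ ((j + 1) ^ 2) = s ^ (j ^ 2) * (s ^ 2) ^ b := by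
        rw [← zpow_natCast s 2, ← zpow_mul, ← zpow_natCast s, ← zpow_add₀ hs0, ← zpow_add₀ hs0, hb]
        congr 1; push_cast; ring
      have e4 : w * w ^ (j - 1) = w ^ j := by rw [← zpow_one_add₀ hw]; congr 1; ring
      have e5 : w⁻¹ * w ^ (j + 1) = w ^ j := by rw [zpow_add_one₀ hw]; field_simp
      have e6 : (-1 : ℂ) ^ (j - 1) = -(-1) ^ j := by rw [zpow_sub_one₀ (by norm_num)]; simp
      have e7 : (-1 : ℂ) ^ (j + 1) = -(-1) ^ j := by rw [zpow_add_one₀ (by norm_num)]; simp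
      have f1 : (s ^ 2) ^ (2 * n + 2) = s ^ 2 * (s ^ 2) ^ (2 * n + 1) := pow_succ' _ _
      have f2 : s ^ (4 * n + 2) = (s ^ 2) ^ (2 * n + 1) := by rw [← pow_mul]; congr 1; ring
      have f3 : (s ^ 2) ^ (2 * n + 1) = (s ^ 2) ^ a * (s ^ 2) ^ b * (s ^ 2)⁻¹ := by
        rw [e1, f1]; field_simp
      rw [f2, ← e1, f3, e6, e7]
      generalize invPoch (s ^ 2) a = ra at *
      generalize invPoch (s ^ 2) b = rb at *
      generalize (s ^ 2) ^ a = A at *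
      generalize (s ^ 2) ^ b = B at *
      calc _ = (-1) ^ j * (s ^ (j ^ 2) * w ^ j) * ra * rb *
              ((1 + A * B * (s ^ 2)⁻¹) * (1 - A) * (1 - B) + A * ((1 - B * (s ^ 2)⁻¹) * (1 - B))
                + B * ((1 - A * (s ^ 2)⁻¹) * (1 - A))) := by ring
        _ = (1 + A * B * (s ^ 2)⁻¹) * ((-1) ^ j * (s ^ (j ^ 2) * w ^ j) *
              ((1 - A) * ra * ((1 - B) * rb))) +
            ((-1) ^ j * (s ^ (j ^ 2) * A) * w ^ j * (ra * ((1 - B * (s ^ 2)⁻¹) * ((1 - B) * rb))) +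
            (-1) ^ j * (s ^ (j ^ 2) * B) * w ^ j *
              ((1 - A * (s ^ 2)⁻¹) * ((1 - A) * ra) * rb)) := by ring
        _ = _ := by
          linear_combination
            -((-1) ^ j * w ^ j * (ra * ((1 - B * (s ^ 2)⁻¹) * ((1 - B) * rb)))) * e2 -
            ((-1) ^ j * (s ^ (2 * n + 1) * s ^ ((j - 1) ^ 2)) *
              (ra * ((1 - B * (s ^ 2)⁻¹) * ((1 - B) * rb)))) * e4 -
            ((-1) ^ j * w ^ j * ((1 - A * (s ^ 2)⁻¹) * ((1 - A) * ra) * rb)) * e3 -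
            ((-1) ^ j * (s ^ (2 * n + 1) * s ^ ((j + 1) ^ 2)) *
              ((1 - A * (s ^ 2)⁻¹) * ((1 - A) * ra) * rb)) * e5
    · rw [poch, poch, mul_add, mul_one, Finset.prod_range_succ (n := 2 * n + 1),
        Finset.prod_range_succ (n := 2 * n), Finset.prod_range_succ, ← pow_succ', ← pow_succ']
      have hq := poch_ne_zero hp (2 * n)
      rw [poch] at hq
      have f3 : w⁻¹ * w = 1 := inv_mul_cancel₀ hw
      have f4 : (1 - w * s * (s ^ 2) ^ n) * (1 - w⁻¹ * s * (s ^ 2) ^ n) =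
          1 + s ^ (4 * n + 2) - w * s ^ (2 * n + 1) - w⁻¹ * s ^ (2 * n + 1) := by
        linear_combination (s ^ (4 * n + 2)) * f3
      rw [f4]
      field_simp
      ring

/-- The Jacobi triple product identity. -/
theorem thetaSum_eq {s w : ℂ} (hs0 : s ≠ 0) (hs : ‖s‖ < 1) (hw : w ≠ 0) :
    thetaSum s w = qp (s ^ 2) (s ^ 2) * (qp (w * s) (s ^ 2) * qp (w⁻¹ * s) (s ^ 2)) := by
  have hp : ‖s ^ 2‖ < 1 := by rw [norm_pow]; exact pow_lt_one₀ (norm_nonneg _) hs two_ne_zero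
  have hE := qp_ne_zero hp hp
  obtain ⟨M, hM0, hM⟩ := exists_norm_invPoch_le hp
  have h1 := tendsto_tsum_of_dominated_convergence (𝓕 := .atTop)
    (f := fun (n : ℕ) (j : ℤ) ↦ (-1) ^ j * (s ^ (j ^ 2) * w ^ j) *
        (invPoch (s ^ 2) (n - j) * invPoch (s ^ 2) (n + j)))
    (g := fun j ↦ (-1) ^ j * (s ^ (j ^ 2) * w ^ j) * ((qp (s ^ 2) (s ^ 2))⁻¹ *
      (qp (s ^ 2) (s ^ 2))⁻¹))
    ((summable_norm_thetaSum hs0 hs hw).mul_right (M * M)) (fun j ↦ ?_) (.of_forall fun n j ↦ ?_)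
  · have h2 : Filter.Tendsto
        (fun n ↦ (∏ k ∈ Finset.range n, ((1 - w * s * (s ^ 2) ^ k) *
          (1 - w⁻¹ * s * (s ^ 2) ^ k))) / poch (s ^ 2) (2 * n)) .atTop
        (nhds ((qp (w * s) (s ^ 2) * qp (w⁻¹ * s) (s ^ 2)) / qp (s ^ 2) (s ^ 2))) := by
      simp only [Finset.prod_mul_distrib]
      exact ((tendsto_qp _ hp).mul (tendsto_qp _ hp)).div
        ((tendsto_poch hp).comp (Filter.tendsto_id.const_mul_atTop' two_pos)) hE
    have h3 := tendsto_nhds_unique h1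
      (h2.congr fun n ↦ (hasSum_finite_triple_product hs0 hs hw n).tsum_eq.symm)
    rw [tsum_mul_right] at h3
    rw [← thetaSum, ← mul_assoc, ← div_eq_mul_inv, div_left_inj' hE, ← div_eq_mul_inv,
      div_eq_iff hE] at h3
    rw [h3, mul_comm]
  · have hn : Filter.Tendsto (fun n : ℕ ↦ (n : ℤ)) .atTop .atTop := tendsto_natCast_atTop_atTop
    refine Filter.Tendsto.const_mul _ (.mul ?_ ?_)
    · exact (tendsto_invPoch hp).comp (Filter.tendsto_atTop_add_const_right _ (-j) hn)
    · exact (tendsto_invPoch hp).comp (Filter.tendsto_atTop_add_const_right _ j hn)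
  · rw [norm_mul, norm_mul (invPoch _ _)]
    gcongr <;> exact hM _

theorem thetaSum_div_mul_thetaSum_div {s x y : ℂ} (hs0 : s ≠ 0) (hs : ‖s‖ < 1) (hx : x ≠ 0)
    (hy : y ≠ 0) :
    thetaSum s (x * y / s) * thetaSum s (x / y / s) =
      x * (oddTheta s x * evenTheta s y - evenTheta s x * oddTheta s y) := by
  have h1 : x * (y * s) = x * y / s * s ^ 2 := by field_simp
  have h2 := thetaSum_shift_mul hs0 hs hx hy
  rw [h1, thetaSum_mul_sq hs0 (div_ne_zero (mul_ne_zero hx hy) hs0), div_mul_cancel₀ _ hs0,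
    ← div_div x y s] at h2
  rw [← neg_sub (evenTheta s x * oddTheta s y), ← h2]
  field_simp

/-- The three-term relation for theta functions. -/
theorem thetaSum_three_term {s x y u v : ℂ} (hs0 : s ≠ 0) (hs : ‖s‖ < 1) (hx : x ≠ 0) (hy : y ≠ 0)
    (hu : u ≠ 0) (hv : v ≠ 0) :
    thetaSum s (x * y / s) * thetaSum s (x / y / s) *
        (thetaSum s (u * v / s) * thetaSum s (u / v / s)) +
      x / y * (thetaSum s (u * x / s) * thetaSum s (u / x / s) *
        (thetaSum s (y * v / s) * thetaSum s (y / v / s))) =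
      thetaSum s (x * v / s) * thetaSum s (x / v / s) *
        (thetaSum s (u * y / s) * thetaSum s (u / y / s)) := by
  rw [thetaSum_div_mul_thetaSum_div hs0 hs hx hy, thetaSum_div_mul_thetaSum_div hs0 hs hu hv,
    thetaSum_div_mul_thetaSum_div hs0 hs hu hx, thetaSum_div_mul_thetaSum_div hs0 hs hy hv,
    thetaSum_div_mul_thetaSum_div hs0 hs hx hv, thetaSum_div_mul_thetaSum_div hs0 hs hu hy]
  field_simp
  ring

theorem thetaSum_pow_div_pow {q : ℂ} (hq0 : q ≠ 0) (hq : ‖q‖ < 1) {a b : ℕ} (hab : a + b = 20) :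
    thetaSum (q ^ 10) (q ^ a / q ^ 10) =
      qp (q ^ 20) (q ^ 20) * (qp (q ^ a) (q ^ 20) * qp (q ^ b) (q ^ 20)) := by
  have hs0 : q ^ 10 ≠ 0 := pow_ne_zero _ hq0
  have hs : ‖q ^ 10‖ < 1 := by rw [norm_pow]; exact pow_lt_one₀ (norm_nonneg _) hq (by norm_num)
  have h1 : (q ^ a / q ^ 10)⁻¹ * q ^ 10 = q ^ b := by
    rw [inv_div, div_mul_eq_mul_div, ← pow_add, div_eq_iff (pow_ne_zero _ hq0), ← pow_add,
      add_comm b, hab]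
  rw [thetaSum_eq hs0 hs (div_ne_zero (pow_ne_zero _ hq0) hs0), div_mul_cancel₀ _ hs0, h1, ← pow_mul]

theorem qp_three_term {q : ℂ} (hq0 : q ≠ 0) (hq : ‖q‖ < 1) {e : ℕ → ℂ}
    (he : ∀ a, qp (q ^ a) (q ^ 20) = e a) :
    e 1 * e 19 * (e 9 * e 11) * (e 8 * e 12) ^ 2 +
      q * (e 3 * e 17 * (e 7 * e 13) * (e 4 * e 16) ^ 2) =
      (e 5 * e 15) ^ 2 * (e 4 * e 16) * (e 8 * e 12) := by
  have hs0 : q ^ 10 ≠ 0 := pow_ne_zero _ hq0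
  have hs : ‖q ^ 10‖ < 1 := by rw [norm_pow]; exact pow_lt_one₀ (norm_nonneg _) hq (by norm_num)
  have hp : ‖q ^ 20‖ < 1 := by rw [norm_pow]; exact pow_lt_one₀ (norm_nonneg _) hq (by norm_num)
  have h := thetaSum_three_term hs0 hs (pow_ne_zero 5 hq0) (pow_ne_zero 4 hq0) (pow_ne_zero 8 hq0)
    one_ne_zero
  simp only [mul_one, div_one] at h
  have d1 : q ^ 5 / q ^ 4 = q ^ 1 := by field_simp
  have d2 : q ^ 8 / q ^ 5 = q ^ 3 := by field_simp
  have d3 : q ^ 8 / q ^ 4 = q ^ 4 := by field_simp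
  rw [d1, d2, d3, ← pow_add, ← pow_add, ← pow_add,
    thetaSum_pow_div_pow hq0 hq (show 5 + 4 + 11 = 20 by norm_num),
    thetaSum_pow_div_pow hq0 hq (show 1 + 19 = 20 by norm_num),
    thetaSum_pow_div_pow hq0 hq (show 8 + 12 = 20 by norm_num),
    thetaSum_pow_div_pow hq0 hq (show 8 + 5 + 7 = 20 by norm_num),
    thetaSum_pow_div_pow hq0 hq (show 3 + 17 = 20 by norm_num),
    thetaSum_pow_div_pow hq0 hq (show 4 + 16 = 20 by norm_num),
    thetaSum_pow_div_pow hq0 hq (show 5 + 15 = 20 by norm_num),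
    thetaSum_pow_div_pow hq0 hq (show 8 + 4 + 8 = 20 by norm_num)] at h
  simp only [he, Nat.reduceAdd] at h
  have hC : e 20 ≠ 0 := he 20 ▸ qp_ne_zero hp hp
  refine mul_left_cancel₀ (pow_ne_zero 4 hC) ?_
  linear_combination h

theorem qp_pow_eq_prod {q : ℂ} (hq : ‖q‖ < 1) {e : ℕ → ℂ} {N : ℕ}
    (he : ∀ a, qp (q ^ a) (q ^ N) = e a) (a m n : ℕ) (hm : m ≠ 0) (hn : n ≠ 0) (hN : m * n = N) :
    qp (q ^ a) (q ^ m) = ∏ i ∈ Finset.range n, e (a + m * i) := by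
  have hqm : ‖q ^ m‖ < 1 := by rw [norm_pow]; exact pow_lt_one₀ (norm_nonneg _) hq hm
  rw [qp_eq_prod _ hqm hn]
  refine Finset.prod_congr rfl fun i _ ↦ ?_
  rw [← he, ← pow_mul, ← pow_mul, ← pow_add, hN]

theorem E_eq_qp (q : ℂ) : E q = qp q q := by
  simp only [E, qp, pow_succ']

theorem stmt_15 : ∀ q : ℂ, ‖q‖ < 1 →
    R q * R (q ^ 2) / R (q ^ 4) ^ 2 + q ^ 2 * R (q ^ 4) ^ 2 / (R q * R (q ^ 2))
      = E (q ^ 2) * E (q ^ 5) ^ 5 / (E q * E (q ^ 10) ^ 5) - 2 * q := by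
  intro q hq
  rcases eq_or_ne q 0 with rfl | hq0
  · simp [R, qp, E]
  obtain ⟨e, he⟩ : ∃ e : ℕ → ℂ, ∀ a, qp (q ^ a) (q ^ 20) = e a := ⟨_, fun _ ↦ rfl⟩
  have hrel := qp_three_term hq0 hq he
  have hne (a : ℕ) : e (a + 1) ≠ 0 := by
    rw [← he]
    refine qp_ne_zero ?_ ?_ <;> rw [norm_pow] <;>
      exact pow_lt_one₀ (norm_nonneg _) hq (by omega)
  have hqp := qp_pow_eq_prod hq he
  have hR1 : R q = (e 1 * e 6 * e 11 * e 16) * (e 4 * e 9 * e 14 * e 19) /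
      ((e 2 * e 7 * e 12 * e 17) * (e 3 * e 8 * e 13 * e 18)) := by
    have h1 := hqp 1 5 4 (by norm_num) (by norm_num) rfl
    rw [pow_one] at h1
    rw [R, h1, hqp 4 5 4 (by norm_num) (by norm_num) rfl, hqp 2 5 4 (by norm_num) (by norm_num) rfl,
      hqp 3 5 4 (by norm_num) (by norm_num) rfl]
    simp only [Finset.prod_range_succ, Finset.prod_range_zero, one_mul, Nat.reduceMul, Nat.reduceAdd]
  have hR2 : R (q ^ 2) = (e 2 * e 12) * (e 8 * e 18) / ((e 4 * e 14) * (e 6 * e 16)) := by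
    simp only [R, ← pow_mul, Nat.reduceMul]
    rw [hqp 2 10 2 (by norm_num) (by norm_num) rfl, hqp 8 10 2 (by norm_num) (by norm_num) rfl,
      hqp 4 10 2 (by norm_num) (by norm_num) rfl, hqp 6 10 2 (by norm_num) (by norm_num) rfl]
    simp only [Finset.prod_range_succ, Finset.prod_range_zero, one_mul, Nat.reduceMul, Nat.reduceAdd]
  have hR4 : R (q ^ 4) = e 4 * e 16 / (e 8 * e 12) := by
    simp only [R, ← pow_mul, Nat.reduceMul, he]
  have hE1 : E q = ∏ i ∈ Finset.range 20, e (i + 1) := by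
    have h1 := hqp 1 1 20 (by norm_num) (by norm_num) rfl
    rw [pow_one] at h1
    rw [E_eq_qp, h1]
    simp only [one_mul, add_comm]
  have hE2 : E (q ^ 2) = ∏ i ∈ Finset.range 10, e (2 + 2 * i) := by
    rw [E_eq_qp, hqp 2 2 10 (by norm_num) (by norm_num) rfl]
  have hE5 : E (q ^ 5) = e 5 * e 10 * e 15 * e 20 := by
    rw [E_eq_qp, hqp 5 5 4 (by norm_num) (by norm_num) rfl]
    simp only [Finset.prod_range_succ, Finset.prod_range_zero, one_mul, Nat.reduceMul, Nat.reduceAdd]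
  have hE10 : E (q ^ 10) = e 10 * e 20 := by
    rw [E_eq_qp, hqp 10 10 2 (by norm_num) (by norm_num) rfl]
    simp only [Finset.prod_range_succ, Finset.prod_range_zero, one_mul, Nat.reduceMul, Nat.reduceAdd]
  simp only [Finset.prod_range_succ, Finset.prod_range_zero, one_mul, Nat.reduceMul, Nat.reduceAdd]
    at hE1 hE2
  have n1 : e 1 ≠ 0 := hne 0
  have n2 : e 2 ≠ 0 := hne 1
  have n3 : e 3 ≠ 0 := hne 2
  have n4 : e 4 ≠ 0 := hne 3
  have n5 : e 5 ≠ 0 := hne 4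
  have n6 : e 6 ≠ 0 := hne 5
  have n7 : e 7 ≠ 0 := hne 6
  have n8 : e 8 ≠ 0 := hne 7
  have n9 : e 9 ≠ 0 := hne 8
  have n10 : e 10 ≠ 0 := hne 9
  have n11 : e 11 ≠ 0 := hne 10
  have n12 : e 12 ≠ 0 := hne 11
  have n13 : e 13 ≠ 0 := hne 12
  have n14 : e 14 ≠ 0 := hne 13
  have n15 : e 15 ≠ 0 := hne 14
  have n16 : e 16 ≠ 0 := hne 15
  have n17 : e 17 ≠ 0 := hne 16
  have n18 : e 18 ≠ 0 := hne 17
  have n19 : e 19 ≠ 0 := hne 18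
  have n20 : e 20 ≠ 0 := hne 19
  have hx : R q * R (q ^ 2) / R (q ^ 4) ^ 2 = (e 1 * e 19 * (e 9 * e 11) * (e 8 * e 12) ^ 2) /
      (e 3 * e 17 * (e 7 * e 13) * (e 4 * e 16) ^ 2) := by
    rw [hR1, hR2, hR4]
    field_simp
  have hy : E (q ^ 2) * E (q ^ 5) ^ 5 / (E q * E (q ^ 10) ^ 5) =
      ((e 5 * e 15) ^ 2 * (e 4 * e 16) * (e 8 * e 12)) ^ 2 /
      ((e 1 * e 19 * (e 9 * e 11) * (e 8 * e 12) ^ 2) *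
      (e 3 * e 17 * (e 7 * e 13) * (e 4 * e 16) ^ 2)) := by
    rw [hE1, hE2, hE5, hE10]
    field_simp
  have hx' : q ^ 2 * R (q ^ 4) ^ 2 / (R q * R (q ^ 2)) =
      q ^ 2 * (R q * R (q ^ 2) / R (q ^ 4) ^ 2)⁻¹ := by
    rw [inv_div, mul_div_assoc]
  have hA : e 1 * e 19 * (e 9 * e 11) * (e 8 * e 12) ^ 2 ≠ 0 := by simp [*]
  have hB : e 3 * e 17 * (e 7 * e 13) * (e 4 * e 16) ^ 2 ≠ 0 := by simp [*]
  rw [hx', hx, hy, ← hrel]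
  generalize e 1 * e 19 * (e 9 * e 11) * (e 8 * e 12) ^ 2 = A at *
  generalize e 3 * e 17 * (e 7 * e 13) * (e 4 * e 16) ^ 2 = B at *
  field_simp
  ring
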